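/- Let g ≥ 2 and let e ∈ ℤ^{2g} be a primitive vector. Set e^⊥ = {v ∈ ℤ^{2g} : ω(e, v) = 0}. Then ℤ·e ⊆ e^⊥, the form ω descends to a well-defined alternating ℤ-bilinear form ω̄ on the quotient module e^⊥/ℤ·e, and there is an isomorphism of ℤ-modules e^⊥/ℤ·e ≅ ℤ^{2g−2} carrying ω̄ to the standard symplectic form on ℤ^{2g−2}. -/

import Mathlib

open scoped BigOperators

/-- The standard symplectic form
`ω(x,y) = Σ_{i=0}^{g-1} (x_{2i}·y_{2i+1} − x_{2i+1}·y_{2i})` on `R^{2g}`. -/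
def stdSymp {R : Type*} [CommRing R] (g : ℕ) (x y : Fin (2 * g) → R) : R :=
  ∑ i : Fin g,
    (x ⟨2 * i.val, by have := i.isLt; omega⟩ * y ⟨2 * i.val + 1, by have := i.isLt; omega⟩
      - x ⟨2 * i.val + 1, by have := i.isLt; omega⟩ * y ⟨2 * i.val, by have := i.isLt; omega⟩)

/-- The linear functional `v ↦ ω(e, v)` on `ℤ^{2g}`. -/
def sympPairing (g : ℕ) (e : Fin (2 * g) → ℤ) : (Fin (2 * g) → ℤ) →ₗ[ℤ] ℤ where
  toFun v := stdSymp g e v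
  map_add' := by
    intro v w
    simp only [stdSymp, Pi.add_apply]
    rw [← Finset.sum_add_distrib]
    exact Finset.sum_congr rfl (fun i _ => by ring)
  map_smul' := by
    intro c v
    simp only [stdSymp, Pi.smul_apply, smul_eq_mul, RingHom.id_apply]
    rw [Finset.mul_sum]
    exact Finset.sum_congr rfl (fun i _ => by ring)

/-- The symplectic orthogonal complement `e^⊥ = {v ∈ ℤ^{2g} : ω(e,v) = 0}`. -/
def sympPerp (g : ℕ) (e : Fin (2 * g) → ℤ) : Submodule ℤ (Fin (2 * g) → ℤ) :=
  LinearMap.ker (sympPairing g e)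

/-- The line `ℤ·e`, viewed as a submodule of `e^⊥`. -/
def lineIn (g : ℕ) (e : Fin (2 * g) → ℤ) : Submodule ℤ ↥(sympPerp g e) :=
  (Submodule.span ℤ {e}).comap (sympPerp g e).subtype

/-- Prepend two coordinates. -/
def packEquiv (n : ℕ) : ((ℤ × ℤ) × (Fin (2 * n) → ℤ)) ≃ₗ[ℤ] (Fin (2 * (n + 1)) → ℤ) where
  toFun p := (Fin.cons p.1.1 (Fin.cons p.1.2 p.2 : Fin (2 * n + 1) → ℤ) : Fin (2 * n + 1 + 1) → ℤ)
  invFun v := ((v ⟨0, by omega⟩, v ⟨1, by omega⟩), fun i => v ⟨i.val + 2, by omega⟩)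
  map_add' p q := by
    funext (i : Fin (2 * n + 1 + 1))
    refine Fin.cases ?_ (fun j => ?_) i
    · rfl
    · refine Fin.cases ?_ (fun k => ?_) j <;> rfl
  map_smul' c p := by
    funext (i : Fin (2 * n + 1 + 1))
    refine Fin.cases ?_ (fun j => ?_) i
    · rfl
    · refine Fin.cases ?_ (fun k => ?_) j <;> rfl
  left_inv p := rfl
  right_inv v := by
    funext (i : Fin (2 * n + 1 + 1))
    refine Fin.cases ?_ (fun j => ?_) i
    · rfl
    · refine Fin.cases ?_ (fun k => ?_) j <;> rfl

lemma stdSymp_pack (n : ℕ) (p q : (ℤ × ℤ) × (Fin (2 * n) → ℤ)) :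
    stdSymp (n + 1) (packEquiv n p) (packEquiv n q)
      = p.1.1 * q.1.2 - p.1.2 * q.1.1 + stdSymp n p.2 q.2 := by
  unfold stdSymp
  rw [Fin.sum_univ_succ]
  rfl

lemma stdSymp_anti (g : ℕ) (x y : Fin (2 * g) → ℤ) : stdSymp g x y = - stdSymp g y x := by
  simp only [stdSymp]
  rw [← Finset.sum_neg_distrib]
  exact Finset.sum_congr rfl (fun i _ => by ring)

/-- The standard form as a bilinear map. -/
def stdB (g : ℕ) : (Fin (2 * g) → ℤ) →ₗ[ℤ] (Fin (2 * g) → ℤ) →ₗ[ℤ] ℤ where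
  toFun := sympPairing g
  map_add' x y := by
    refine LinearMap.ext fun v => ?_
    change stdSymp g (x + y) v = stdSymp g x v + stdSymp g y v
    rw [stdSymp_anti g _ v, stdSymp_anti g x v, stdSymp_anti g y v]
    have := (sympPairing g v).map_add x y
    change stdSymp g v (x + y) = stdSymp g v x + stdSymp g v y at this
    rw [this]; ring
  map_smul' c x := by
    refine LinearMap.ext fun v => ?_
    change stdSymp g (c • x) v = c * stdSymp g x v
    rw [stdSymp_anti g _ v, stdSymp_anti g x v]
    have := (sympPairing g v).map_smul c x
    change stdSymp g v (c • x) = c * stdSymp g v x at this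
    rw [this]; ring

lemma stdB_apply (g : ℕ) (x y : Fin (2 * g) → ℤ) : stdB g x y = stdSymp g x y := rfl

lemma stdB_alt (g : ℕ) (x : Fin (2 * g) → ℤ) : stdB g x x = 0 := by
  have := stdSymp_anti g x x
  rw [stdB_apply]; omega

lemma stdB_surj (g : ℕ) : Function.Surjective (stdB g) := by
  induction g with
  | zero =>
    intro φ
    refine ⟨0, LinearMap.ext fun v => ?_⟩
    have : v = 0 := by funext i; exact absurd i.isLt (by omega)
    rw [this, map_zero, map_zero]
  | succ n ih =>
    intro φ
    let ψ := φ ∘ₗ (packEquiv n).toLinearMap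
    obtain ⟨m, hm⟩ := ih (ψ ∘ₗ LinearMap.inr ℤ (ℤ × ℤ) (Fin (2 * n) → ℤ))
    refine ⟨packEquiv n ((ψ ((0, 1), 0), - ψ ((1, 0), 0)), m), LinearMap.ext fun v => ?_⟩
    obtain ⟨q, rfl⟩ := (packEquiv n).surjective v
    rw [stdB_apply, stdSymp_pack, ← stdB_apply, hm]
    have hq : q = q.1.1 • ((1, 0), 0) + q.1.2 • ((0, 1), 0)
        + LinearMap.inr ℤ (ℤ × ℤ) (Fin (2 * n) → ℤ) q.2 := by
      ext <;> simp
    change _ = ψ q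
    conv_rhs => rw [hq, map_add, map_add, map_smul, map_smul]
    simp only [LinearMap.comp_apply, smul_eq_mul]
    ring

section split

variable {M : Type} [AddCommGroup M] (B : M →ₗ[ℤ] M →ₗ[ℤ] ℤ)

/-- Complement of a hyperbolic pair. -/
def hypPerp (e f : M) : Submodule ℤ M := LinearMap.ker (B e) ⊓ LinearMap.ker (B f)

lemma mem_hypPerp (e f x : M) : x ∈ hypPerp B e f ↔ B e x = 0 ∧ B f x = 0 := by
  simp [hypPerp]

lemma alt_anti (halt : ∀ x, B x x = 0) (x y : M) : B x y = - B y x := by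
  have h := halt (x + y)
  simp only [map_add, LinearMap.add_apply, halt] at h
  omega

/-- Projection to the complement. -/
def hypProj (halt : ∀ x, B x x = 0) (e f : M) (hef : B e f = 1) : M →ₗ[ℤ] hypPerp B e f where
  toFun x := ⟨x + B f x • e - B e x • f, by
    have h1 := alt_anti B halt f e
    rw [mem_hypPerp]
    simp only [map_add, map_sub, map_smul, halt, hef, h1, smul_eq_mul]
    constructor <;> ring⟩
  map_add' x y := by
    ext1
    simp only [map_add, Submodule.coe_add]
    module
  map_smul' c x := by
    ext1
    simp only [map_smul, smul_eq_mul, Submodule.coe_smul, RingHom.id_apply]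
    module

lemma hypProj_coe (halt : ∀ x, B x x = 0) (e f : M) (hef : B e f = 1) (x : M) :
    (hypProj B halt e f hef x : M) = x + B f x • e - B e x • f := rfl

lemma hypProj_of_mem (halt : ∀ x, B x x = 0) (e f : M) (hef : B e f = 1) (x : hypPerp B e f) :
    hypProj B halt e f hef x = x := by
  ext1
  have := (mem_hypPerp B e f x).1 x.2
  rw [hypProj_coe, this.1, this.2]; module

/-- The splitting. -/
def splitEquiv (halt : ∀ x, B x x = 0) (e f : M) (hef : B e f = 1) :
    M ≃ₗ[ℤ] ((ℤ × ℤ) × hypPerp B e f) where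
  toFun x := ((- B f x, B e x), hypProj B halt e f hef x)
  invFun p := p.1.1 • e + p.1.2 • f + p.2
  map_add' x y := by
    ext <;> simp <;> ring
  map_smul' c x := by
    ext <;> simp
  left_inv x := by
    simp only [hypProj_coe]; module
  right_inv p := by
    have h1 := alt_anti B halt f e
    obtain ⟨⟨a, b⟩, n⟩ := p
    have h := (mem_hypPerp B e f n).1 n.2
    refine Prod.ext (Prod.ext ?_ ?_) (Subtype.ext ?_)
    · simp [h, halt, h1, hef]
    · simp [h, halt, hef]
    · rw [hypProj_coe]
      simp only [map_add, map_smul, halt, hef, h1, h.1, h.2, smul_eq_mul]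
      module

lemma split_form (halt : ∀ x, B x x = 0) (e f : M) (hef : B e f = 1) (x y : M) :
    B x y = (- B f x) * B e y - B e x * (- B f y)
      + B (hypProj B halt e f hef x) (hypProj B halt e f hef y) := by
  have h1 := alt_anti B halt f e
  have h2 := alt_anti B halt x e
  have h3 := alt_anti B halt x f
  simp only [hypProj_coe, map_add, map_sub, map_smul, LinearMap.add_apply, LinearMap.sub_apply,
    LinearMap.smul_apply, halt, hef, h1, h2, h3, smul_eq_mul]
  ring

/-- Restricted form. -/
def resB (e f : M) : hypPerp B e f →ₗ[ℤ] hypPerp B e f →ₗ[ℤ] ℤ :=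
  B.compl₁₂ (hypPerp B e f).subtype (hypPerp B e f).subtype

lemma resB_apply (e f : M) (x y : hypPerp B e f) : resB B e f x y = B x y := rfl

lemma resB_surj (halt : ∀ x, B x x = 0) (hs : Function.Surjective B) (e f : M)
    (hef : B e f = 1) : Function.Surjective (resB B e f) := by
  intro φ
  obtain ⟨m, hm⟩ := hs (φ ∘ₗ hypProj B halt e f hef)
  refine ⟨hypProj B halt e f hef m, LinearMap.ext fun y => ?_⟩
  have h := split_form B halt e f hef m y
  have hy := (mem_hypPerp B e f y).1 y.2
  rw [hm, LinearMap.comp_apply, hypProj_of_mem, hy.1, hy.2] at h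
  rw [resB_apply, h]; ring

end split

lemma exists_symplectic_basis (k : ℕ) : ∀ (M : Type) [AddCommGroup M] [Module.Free ℤ M]
    [Module.Finite ℤ M] (B : M →ₗ[ℤ] M →ₗ[ℤ] ℤ), Module.finrank ℤ M = k →
    (∀ x, B x x = 0) → Function.Surjective B →
    ∃ (n : ℕ) (φ : M ≃ₗ[ℤ] (Fin (2 * n) → ℤ)), ∀ x y, stdSymp n (φ x) (φ y) = B x y := by
  induction k using Nat.strong_induction_on with
  | _ k ih =>
  intro M _ _ _ B hk halt hs
  let b := Module.Free.chooseBasis ℤ M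
  rcases isEmpty_or_nonempty (Module.Free.ChooseBasisIndex ℤ M) with hE | ⟨⟨i⟩⟩
  · have hsub : Subsingleton M := b.repr.toEquiv.subsingleton
    refine ⟨0, LinearEquiv.ofFinrankEq _ _ ?_, fun x y => ?_⟩
    · rw [Module.finrank_zero_of_subsingleton]; simp
    · rw [Subsingleton.elim x 0, map_zero, map_zero]
      simp [stdSymp]
  · obtain ⟨e, he⟩ := hs (b.coord i)
    have hef : B e (b i) = 1 := by rw [he]; simp
    have S := splitEquiv B halt e (b i) hef
    have hfr : Module.finrank ℤ M = 2 + Module.finrank ℤ (hypPerp B e (b i)) := by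
      rw [S.finrank_eq, Module.finrank_prod, Module.finrank_prod]; simp
    obtain ⟨n, φ, hφ⟩ := ih _ (by omega) (hypPerp B e (b i)) (resB B e (b i)) rfl
      (fun x => halt x) (resB_surj B halt hs e (b i) hef)
    refine ⟨n + 1, (splitEquiv B halt e (b i) hef).trans
      (((LinearEquiv.refl ℤ (ℤ × ℤ)).prodCongr φ).trans (packEquiv n)), fun x y => ?_⟩
    rw [split_form B halt e (b i) hef x y, ← resB_apply, ← hφ]
    exact stdSymp_pack n _ _

/-- **The symplectic reduction `e^⊥/ℤ·e` of `ℤ^{2g}` by a primitive vector.**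
For `g ≥ 2` and a primitive vector `e ∈ ℤ^{2g}`: `ℤ·e ⊆ e^⊥`; the form `ω`
descends to a well-defined form on the quotient `e^⊥/ℤ·e`; and there is a
`ℤ`-module isomorphism `e^⊥/ℤ·e ≅ ℤ^{2g−2}` carrying the descended form to
the standard symplectic form on `ℤ^{2g−2}` (which is in particular
alternating and `ℤ`-bilinear). -/
theorem symplectic_reduction_by_primitive_vector
    (g : ℕ) (hg : 2 ≤ g) (e : Fin (2 * g) → ℤ)
    (he : ∀ d : ℤ, (∀ i, d ∣ e i) → IsUnit d) :
    Submodule.span ℤ {e} ≤ sympPerp g e ∧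
    (∀ x y x' y' : ↥(sympPerp g e),
      Submodule.Quotient.mk (p := lineIn g e) x = Submodule.Quotient.mk x' →
      Submodule.Quotient.mk (p := lineIn g e) y = Submodule.Quotient.mk y' →
      stdSymp g (x : Fin (2 * g) → ℤ) (y : Fin (2 * g) → ℤ)
        = stdSymp g (x' : Fin (2 * g) → ℤ) (y' : Fin (2 * g) → ℤ)) ∧
    ∃ f : (↥(sympPerp g e) ⧸ lineIn g e) ≃ₗ[ℤ] (Fin (2 * (g - 1)) → ℤ),
      ∀ x y : ↥(sympPerp g e),
        stdSymp (g - 1) (f (Submodule.Quotient.mk x)) (f (Submodule.Quotient.mk y))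
          = stdSymp g (x : Fin (2 * g) → ℤ) (y : Fin (2 * g) → ℤ) := by
  have hee : e ∈ sympPerp g e := stdB_alt g e
  have hperp : ∀ x : sympPerp g e, stdB g e x = 0 := fun x => x.2
  have hperp' : ∀ x : sympPerp g e, stdB g x e = 0 := fun x => by
    rw [alt_anti _ (stdB_alt g), hperp, neg_zero]
  refine ⟨?_, ?_, ?_⟩
  · rw [Submodule.span_singleton_le_iff_mem]; exact hee
  · intro x y x' y' hx hy
    rw [Submodule.Quotient.eq] at hx hy
    obtain ⟨a, ha⟩ := Submodule.mem_span_singleton.1 (Submodule.mem_comap.1 hx)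
    obtain ⟨c, hc⟩ := Submodule.mem_span_singleton.1 (Submodule.mem_comap.1 hy)
    have hx2 : (x : Fin (2 * g) → ℤ) = x' + a • e := by rw [ha]; simp
    have hy2 : (y : Fin (2 * g) → ℤ) = y' + c • e := by rw [hc]; simp
    rw [← stdB_apply, ← stdB_apply, hx2, hy2]
    simp only [map_add, map_smul, LinearMap.add_apply, LinearMap.smul_apply, hperp, hperp',
      stdB_alt, smul_zero, add_zero]
  · obtain ⟨f, hef⟩ : ∃ f, stdB g e f = 1 := by
      obtain ⟨d, hd⟩ := (IsPrincipalIdealRing.principal (LinearMap.range (stdB g e) : Ideal ℤ)).principal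
      have hu : IsUnit d := he d fun i => by
        obtain ⟨m, hm⟩ := stdB_surj g (LinearMap.proj i)
        have h1 : e i = stdB g e (-m) := by
          rw [map_neg, ← alt_anti _ (stdB_alt g), hm]; rfl
        have h2 : e i ∈ LinearMap.range (stdB g e) := ⟨_, h1.symm⟩
        rw [hd] at h2
        exact Ideal.mem_span_singleton.1 h2
      have h1 : (1 : ℤ) ∈ LinearMap.range (stdB g e) := by
        rw [hd]
        exact Ideal.mem_span_singleton.2 hu.dvd
      exact h1
    have halt := stdB_alt g
    obtain ⟨n, φ, hφ⟩ := exists_symplectic_basis _ (hypPerp (stdB g) e f) (resB (stdB g) e f) rfl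
      (fun x => halt x) (resB_surj (stdB g) halt (stdB_surj g) e f hef)
    have hn : n = g - 1 := by
      have h1 := (splitEquiv (stdB g) halt e f hef).finrank_eq
      rw [Module.finrank_prod, Module.finrank_prod, φ.finrank_eq] at h1
      simp at h1
      omega
    subst hn
    let P := hypProj (stdB g) halt e f hef
    let T : sympPerp g e →ₗ[ℤ] (Fin (2 * (g - 1)) → ℤ) :=
      φ.toLinearMap ∘ₗ P ∘ₗ (sympPerp g e).subtype
    have hTs : Function.Surjective T := by
      intro v
      obtain ⟨z, rfl⟩ := φ.surjective v
      refine ⟨⟨z, ((mem_hypPerp (stdB g) e f z).1 z.2).1⟩, ?_⟩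
      exact congrArg φ (hypProj_of_mem (stdB g) halt e f hef z)
    have hk : lineIn g e = LinearMap.ker T := by
      ext x
      rw [LinearMap.mem_ker]
      have h0 : T x = 0 ↔ (x : Fin (2 * g) → ℤ) + stdB g f x • e = 0 := by
        change φ (P x) = 0 ↔ _
        rw [LinearEquiv.map_eq_zero_iff, ← Submodule.coe_eq_zero, hypProj_coe, hperp, zero_smul,
          sub_zero]
      rw [h0]
      change (x : Fin (2 * g) → ℤ) ∈ Submodule.span ℤ {e} ↔ _
      rw [Submodule.mem_span_singleton]
      constructor
      · rintro ⟨a, ha⟩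
        rw [← ha, map_smul, alt_anti _ halt f e, hef]
        module
      · intro h
        exact ⟨- stdB g f x, by rw [neg_smul]; exact (eq_neg_of_add_eq_zero_left h).symm⟩
    refine ⟨(Submodule.quotEquivOfEq _ _ hk).trans (T.quotKerEquivOfSurjective hTs), fun x y => ?_⟩
    change stdSymp (g - 1) (φ (P x)) (φ (P y)) = _
    rw [hφ, resB_apply, ← stdB_apply, split_form (stdB g) halt e f hef x y, hperp, hperp]
    simp [P]
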